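/- There exist integers N₀ and M₀ such that the following holds for every odd integer m ≥ M₀ and every integer n with n ≥ N₀ and n ≥ 4m. Let G be a graph on 3n + 4 vertices that contains no copy of K_{2,n} and whose complement G̅ contains no copy of W_m. Let v be a vertex whose degree in G̅ equals the maximum degree Δ(G̅), suppose (3/2)(n + 1) ≤ Δ(G̅) ≤ 2(n + 1), let H̅ denote the subgraph of G̅ induced on N_{G̅}(v), and let Q be the set of vertices x ∈ N_{G̅}(v) with deg_{H̅}(x) ≥ |N_{G̅}(v)|/6 + 1. Then the subgraph of G̅ induced on Q is not bipartite. -/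

import Mathlib

open SimpleGraph

/-- `ContainsCopy Γ H` : `Γ` contains a copy of `H`, i.e. `H` is isomorphic to a subgraph
of `Γ`; equivalently, there is an injective graph homomorphism from `H` to `Γ`. -/
def ContainsCopy {α β : Type*} (Γ : SimpleGraph α) (H : SimpleGraph β) : Prop :=
  ∃ f : H →g Γ, Function.Injective f

/-- The wheel graph `W_m` on `m+1` vertices: the join of a single hub vertex (`none`)
with the cycle `C_m` (on the vertices `some i`). -/
def wheelGraph (m : ℕ) : SimpleGraph (Option (Fin m)) :=
  SimpleGraph.fromRel (fun x y =>
    x = none ∨ ∃ i j : Fin m, x = some i ∧ y = some j ∧ (SimpleGraph.cycleGraph m).Adj i j)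

/-- A graph is bipartite if its vertex set can be partitioned into two parts with every
edge joining the two parts. -/
def IsBip {α : Type*} (G : SimpleGraph α) : Prop :=
  ∃ A : Set α, ∀ ⦃x y⦄, G.Adj x y → (x ∈ A ↔ y ∉ A)

section Counting

open Finset
open scoped Classical

variable {V : Type*}

/-- The number of `G`-neighbours of `u` in `S`, as a real number. -/
noncomputable def relDeg (G : SimpleGraph V) (S : Finset V) (u : V) : ℝ :=
  (#{x ∈ S | G.Adj u x} : ℝ)

lemma relDeg_nonneg (G : SimpleGraph V) (S : Finset V) (u : V) : 0 ≤ relDeg G S u :=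
  Nat.cast_nonneg _

lemma relDeg_le_card (G : SimpleGraph V) (S : Finset V) (u : V) : relDeg G S u ≤ #S := by
  unfold relDeg; exact_mod_cast card_filter_le _ _

lemma relDeg_add_not (G : SimpleGraph V) (S : Finset V) (u : V) :
    relDeg G S u + (#{x ∈ S | ¬ G.Adj u x} : ℝ) = #S := by
  unfold relDeg; exact_mod_cast card_filter_add_card_filter_not _

lemma relDeg_eq_card {G : SimpleGraph V} {S : Finset V} {u : V} (h : ∀ x ∈ S, G.Adj u x) :
    relDeg G S u = #S := by
  unfold relDeg; rw [filter_true_of_mem h]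

lemma relDeg_union {G : SimpleGraph V} {S T : Finset V} (h : Disjoint S T) (u : V) :
    relDeg G (S ∪ T) u = relDeg G S u + relDeg G T u := by
  unfold relDeg
  rw [filter_union, card_union_of_disjoint (disjoint_filter_filter h)]
  push_cast; rfl

lemma sum_relDeg_comm (G : SimpleGraph V) (S Z : Finset V) :
    ∑ z ∈ Z, relDeg G S z = ∑ x ∈ S, relDeg G Z x := by
  have := sum_card_bipartiteAbove_eq_sum_card_bipartiteBelow (s := Z) (t := S)
    (fun z x => G.Adj z x)
  unfold relDeg
  simp only [bipartiteAbove, bipartiteBelow] at this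
  simp only [G.adj_comm] at this ⊢
  exact_mod_cast this

lemma sum_relDeg_sq_sub_le {G : SimpleGraph V} {S Z : Finset V} {c : ℝ}
    (h : ∀ x ∈ S, ∀ y ∈ S, x ≠ y → (#{z ∈ Z | G.Adj z x ∧ G.Adj z y} : ℝ) ≤ c) :
    ∑ z ∈ Z, (relDeg G S z ^ 2 - relDeg G S z) ≤ #S * (#S - 1) * c := by
  have e1 : ∀ z, relDeg G S z ^ 2 - relDeg G S z
      = ∑ p ∈ S.offDiag, if G.Adj z p.1 ∧ G.Adj z p.2 then (1 : ℝ) else 0 := by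
    intro z
    have : {p ∈ S.offDiag | G.Adj z p.1 ∧ G.Adj z p.2} = ({x ∈ S | G.Adj z x}).offDiag := by
      ext p; simp only [mem_filter, mem_offDiag]; tauto
    rw [← sum_filter, this, sum_const, offDiag_card, nsmul_eq_mul, mul_one,
      Nat.cast_sub (Nat.le_mul_self _)]
    unfold relDeg; push_cast; ring
  simp only [e1]
  rw [sum_comm]
  have e2 : ∀ p ∈ S.offDiag,
      (∑ z ∈ Z, if G.Adj z p.1 ∧ G.Adj z p.2 then (1 : ℝ) else 0) ≤ c := by
    intro p hp
    rw [mem_offDiag] at hp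
    simpa using h p.1 hp.1 p.2 hp.2.1 hp.2.2
  refine (sum_le_card_nsmul _ _ _ e2).trans_eq ?_
  rw [offDiag_card, nsmul_eq_mul, Nat.cast_sub (Nat.le_mul_self _)]
  push_cast; ring

lemma sum_relDeg_sq_le {G : SimpleGraph V} {S Z : Finset V} :
    (∑ z ∈ Z, relDeg G S z) ^ 2
      ≤ #Z * (∑ z ∈ Z, (relDeg G S z ^ 2 - relDeg G S z) + ∑ z ∈ Z, relDeg G S z) := by
  rw [← sum_add_distrib]
  simpa using sq_sum_le_card_mul_sum_sq (s := Z) (f := fun z => relDeg G S z)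

lemma relDeg_sq_sub_nonneg (G : SimpleGraph V) (X : Finset V) (z : V) :
    0 ≤ relDeg G X z ^ 2 - relDeg G X z := by
  unfold relDeg
  have : (#{x ∈ X | G.Adj z x}) ≤ #{x ∈ X | G.Adj z x} ^ 2 := Nat.le_self_pow (by norm_num) _
  have : (#{x ∈ X | G.Adj z x} : ℝ) ≤ (#{x ∈ X | G.Adj z x} : ℝ) ^ 2 := by exact_mod_cast this
  linarith

variable [Fintype V]

/-- A clique `A` in a graph on `3n+4` vertices in which distinct vertices have at most `n-1`
common neighbours and the vertices of `A` have degree at least `n+1+s`. -/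
structure DenseClique (G : SimpleGraph V) (n : ℕ) (s : ℝ) (A : Finset V) : Prop where
  card_verts : (Fintype.card V : ℝ) = 3 * n + 4
  adj : ∀ x ∈ A, ∀ y ∈ A, x ≠ y → G.Adj x y
  deg : ∀ x ∈ A, (n : ℝ) + 1 + s ≤ relDeg G univ x
  codeg : ∀ x y, x ≠ y → (#{z | G.Adj z x ∧ G.Adj z y} : ℝ) ≤ n - 1

namespace DenseClique

variable {G : SimpleGraph V} {n : ℕ} {s : ℝ} {A X : Finset V}

lemma card_compl (h : DenseClique G n s A) : (#Aᶜ : ℝ) = 3 * n + 4 - #A := by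
  rw [Finset.card_compl, Nat.cast_sub (card_le_univ _), h.card_verts]

lemma codeg_compl (h : DenseClique G n s A) {x y : V} (hx : x ∈ A) (hy : y ∈ A) (hxy : x ≠ y) :
    (#{z ∈ Aᶜ | G.Adj z x ∧ G.Adj z y} : ℝ) ≤ n + 1 - #A := by
  have h1 := h.codeg x y hxy
  have hsub : {z ∈ Aᶜ | G.Adj z x ∧ G.Adj z y} ∪ (A.erase x).erase y
      ⊆ univ.filter (fun z => G.Adj z x ∧ G.Adj z y) := by
    intro z hz
    simp only [mem_union, mem_filter, mem_erase, mem_univ, true_and] at hz ⊢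
    rcases hz with hz | hz
    · exact hz.2
    · exact ⟨h.adj z hz.2.2 x hx hz.2.1, h.adj z hz.2.2 y hy hz.1⟩
  have hdis : Disjoint {z ∈ Aᶜ | G.Adj z x ∧ G.Adj z y} ((A.erase x).erase y) := by
    rw [Finset.disjoint_left]; intro z hz hz'
    simp only [mem_filter, mem_erase, mem_compl] at hz hz'
    exact hz.1 hz'.2.2
  have h2 := card_le_card hsub
  rw [card_union_of_disjoint hdis] at h2
  have h3 := card_erase_add_one (mem_erase.2 ⟨hxy.symm, hy⟩ : y ∈ A.erase x)
  have h4 := card_erase_add_one hx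
  have h2' : (#{z ∈ Aᶜ | G.Adj z x ∧ G.Adj z y} : ℝ) + #((A.erase x).erase y)
      ≤ #{z | G.Adj z x ∧ G.Adj z y} := by exact_mod_cast h2
  have h3' : (#((A.erase x).erase y) : ℝ) + 1 = #(A.erase x) := by exact_mod_cast h3
  have h4' : (#(A.erase x) : ℝ) + 1 = #A := by exact_mod_cast h4
  linarith

lemma card_le (h : DenseClique G n s A) : (#A : ℝ) ≤ n + 1 := by
  rcases le_or_gt #A 1 with h1 | h1
  · have : (#A : ℝ) ≤ 1 := by exact_mod_cast h1
    have : (0 : ℝ) ≤ n := Nat.cast_nonneg n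
    linarith
  · obtain ⟨x, hx, y, hy, hxy⟩ := one_lt_card.1 h1
    have := h.codeg_compl hx hy hxy
    have h0 : (0 : ℝ) ≤ #{z ∈ Aᶜ | G.Adj z x ∧ G.Adj z y} := Nat.cast_nonneg _
    linarith

lemma le_sum_relDeg (h : DenseClique G n s A) (hX : X ⊆ A) :
    #X * (n + 2 + s - #A) ≤ ∑ z ∈ Aᶜ, relDeg G X z := by
  rw [sum_relDeg_comm, ← nsmul_eq_mul]
  refine card_nsmul_le_sum _ _ _ fun x hx => ?_
  have h1 := h.deg x (hX hx)
  have h2 := relDeg_union (G := G) (disjoint_compl_right (a := A)) x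
  rw [union_compl] at h2
  have h3 : relDeg G A x ≤ #A - 1 := by
    have : {y ∈ A | G.Adj x y} ⊆ A.erase x := by
      intro y hy
      rw [mem_filter] at hy
      exact mem_erase.2 ⟨hy.2.ne', hy.1⟩
    have h4 := card_le_card this
    have h5 := card_erase_add_one (hX hx)
    have : (#{y ∈ A | G.Adj x y} : ℝ) + 1 ≤ #A := by exact_mod_cast (by omega)
    unfold relDeg; linarith
  linarith

lemma sum_sq_sub_le (h : DenseClique G n s A) (hX : X ⊆ A) :
    ∑ z ∈ Aᶜ, (relDeg G X z ^ 2 - relDeg G X z) ≤ #X * (#X - 1) * (n + 1 - #A) :=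
  sum_relDeg_sq_sub_le fun _ hx _ hy hxy => h.codeg_compl (hX hx) (hX hy) hxy

/-- A common neighbourhood of `1000` vertices of a dense clique is small. -/
lemma card_common_le (h : DenseClique G n s A) (hn : 10 ^ 6 ≤ n) (hs0 : 0 ≤ s)
    (hs : 2 * s ≤ n + 1) (hX : X ⊆ A) (hK : #X = 1000) {M : Finset V} (hM : M ⊆ Aᶜ)
    (hMX : ∀ u ∈ M, ∀ x ∈ X, G.Adj u x) :
    (#M : ℝ) ≤ (n + 1 - #A) - s + 28 / 100 * n := by
  have h1 := h.le_sum_relDeg hX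
  have h2 := h.sum_sq_sub_le hX
  rw [← sum_sdiff hM] at h1 h2
  have e1 : ∑ z ∈ M, relDeg G X z = #M * 1000 := by
    rw [sum_congr rfl (fun z hz => relDeg_eq_card (hMX z hz)), sum_const, hK, nsmul_eq_mul]
    norm_num
  have e2 : ∑ z ∈ M, (relDeg G X z ^ 2 - relDeg G X z) = #M * 999000 := by
    rw [sum_congr rfl (fun z hz => by rw [relDeg_eq_card (hMX z hz)]), sum_const, hK, nsmul_eq_mul]
    norm_num
  have h3 := sum_relDeg_sq_le (G := G) (S := X) (Z := Aᶜ \ M)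
  have h4 : (#(Aᶜ \ M) : ℝ) = 3 * n + 4 - #A - #M := by
    rw [card_sdiff_of_subset hM, Nat.cast_sub (card_le_card hM), h.card_compl]
  have h5 : ∑ z ∈ Aᶜ \ M, relDeg G X z ≤ #(Aᶜ \ M) * 1000 := by
    rw [← nsmul_eq_mul]
    refine sum_le_card_nsmul _ _ _ fun z _ => ?_
    simpa [hK] using relDeg_le_card G X z
  have h6 : 0 ≤ ∑ z ∈ Aᶜ \ M, (relDeg G X z ^ 2 - relDeg G X z) :=
    sum_nonneg fun z _ => relDeg_sq_sub_nonneg G X z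
  rw [e1, hK] at h1
  rw [e2, hK] at h2
  rw [h4] at h3 h5
  have hnR : (10 : ℝ) ^ 6 ≤ n := by exact_mod_cast hn
  by_contra hcon
  push Not at hcon
  set T := ∑ z ∈ Aᶜ \ M, relDeg G X z
  set E := ∑ z ∈ Aᶜ \ M, (relDeg G X z ^ 2 - relDeg G X z)
  obtain ⟨z, hz⟩ : ∃ z : ℝ, z = n + 1 - #A - #M := ⟨_, rfl⟩
  have g1 : 1000 * (s + 1 + z) ≤ T := by push_cast at h1; rw [hz]; linarith
  have g2 : E ≤ 999000 * z := by push_cast at h2; rw [hz]; linarith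
  have g0 : 0 ≤ z := by linarith
  have g3 : z < s - 28 / 100 * n := by linarith
  have g4 : T ≤ (2 * n + 3 + z) * 1000 := by rw [hz]; linarith
  have g5 : T ^ 2 ≤ (2 * n + 3 + z) * (E + T) := by
    have : (3 * n + 4 - #A - #M : ℝ) = 2 * n + 3 + z := by rw [hz]; ring
    rwa [this] at h3
  clear_value T E
  clear h1 h2 h3 h4 h5 h6 e1 e2 hz hcon
  have g6 : (1000 * (s + 1 + z)) ^ 2 ≤ T ^ 2 := by gcongr
  have g7 : (2 * n + 3 + z) * (E + T)
      ≤ (2 * n + 3 + z) * (999000 * z + (2 * n + 3 + z) * 1000) := by gcongr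
  have g8 : (s + 1 + z) ^ 2 ≤ (2 * n + 3 + z) * (z + (2 * n + 3 + z) / 1000) := by
    nlinarith
  have g9 : 2 * n + 3 + z ≤ 223 / 100 * n + 3 := by linarith
  have g10 : (2 * n + 3 + z) * (2 * n + 3 + z) ≤ (223 / 100 * n + 3) * (223 / 100 * n + 3) := by
    gcongr
  have g11 : (n - s) * z ≤ (n - s) * (s - 28 / 100 * n) := by
    apply mul_le_mul_of_nonneg_left g3.le; linarith
  nlinarith [sq_nonneg (s - 128 / 300 * n)]

/-- Vertices outside a dense clique `A` that are adjacent to nearly all of `X ⊆ A` are few. -/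
lemma sum_card_sub_le (h : DenseClique G n s A) (hX : X ⊆ A) (hpos : 0 < #X) {E : Finset V}
    (hE : E ⊆ Aᶜ) :
    ∑ u ∈ E, ((#X : ℝ) - 2 * #{x ∈ X | ¬ G.Adj u x} - 1) ≤ #X * (n + 1 - #A) := by
  have hα : (0 : ℝ) ≤ n + 1 - #A := by linarith [h.card_le]
  have hp : (0 : ℝ) < #X := by exact_mod_cast hpos
  have h1 : ∑ u ∈ E, (#X : ℝ) * ((#X : ℝ) - 2 * #{x ∈ X | ¬ G.Adj u x} - 1)
      ≤ ∑ u ∈ E, (relDeg G X u ^ 2 - relDeg G X u) := by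
    refine sum_le_sum fun u _ => ?_
    have := relDeg_add_not G X u
    have h0 : (0 : ℝ) ≤ #{x ∈ X | ¬ G.Adj u x} := Nat.cast_nonneg _
    have : relDeg G X u = #X - #{x ∈ X | ¬ G.Adj u x} := by linarith
    rw [this]
    nlinarith
  have h2 : ∑ u ∈ E, (relDeg G X u ^ 2 - relDeg G X u)
      ≤ ∑ u ∈ Aᶜ, (relDeg G X u ^ 2 - relDeg G X u) :=
    sum_le_sum_of_subset_of_nonneg hE fun z _ _ => relDeg_sq_sub_nonneg G X z
  have h3 := h.sum_sq_sub_le hX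
  rw [← mul_sum] at h1
  have h4 : (#X : ℝ) * (#X - 1) * (n + 1 - #A) ≤ #X * (#X * (n + 1 - #A)) := by nlinarith
  exact le_of_mul_le_mul_left (by linarith) hp

/-- If the degrees in a dense clique `A` exceed `n` substantially, then fewer than `n + 1 - #A`
vertices outside `A` can be adjacent to nearly all of a large `X ⊆ A`. -/
lemma card_attached_le (h : DenseClique G n s A) (hn : 10 ^ 17 ≤ n)
    (hs : (n : ℝ) ≤ 10 ^ 5 * s) (hX : X ⊆ A) (hXn : (12 / 100 : ℝ) * n ≤ #X) {E : Finset V}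
    (hE : E ⊆ Aᶜ) (hEX : ∀ u ∈ E, #{x ∈ X | ¬ G.Adj u x} ≤ 1000) :
    (#E : ℝ) + 1000 ≤ n + 1 - #A := by
  have hnR : (10 : ℝ) ^ 17 ≤ n := by exact_mod_cast hn
  have hp : (0 : ℝ) < #X := by linarith
  have h1 := h.le_sum_relDeg hX
  have h2 := h.sum_sq_sub_le hX
  rw [← sum_sdiff hE] at h1 h2
  have e1 : ∑ z ∈ E, relDeg G X z ≤ #E * #X := by
    rw [← nsmul_eq_mul]
    exact sum_le_card_nsmul _ _ _ fun z _ => relDeg_le_card G X z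
  have e2 : #E * ((#X : ℝ) * (#X - 2001)) ≤ ∑ z ∈ E, (relDeg G X z ^ 2 - relDeg G X z) := by
    rw [← nsmul_eq_mul]
    refine card_nsmul_le_sum _ _ _ fun u hu => ?_
    have h3 := relDeg_add_not G X u
    have h4 : (#{x ∈ X | ¬ G.Adj u x} : ℝ) ≤ 1000 := by exact_mod_cast hEX u hu
    have h0 : (0 : ℝ) ≤ #{x ∈ X | ¬ G.Adj u x} := Nat.cast_nonneg _
    have : relDeg G X u = #X - #{x ∈ X | ¬ G.Adj u x} := by linarith
    rw [this]
    nlinarith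
  have h3 := sum_relDeg_sq_le (G := G) (S := X) (Z := Aᶜ \ E)
  have hV : ∀ S : Finset V, (#S : ℝ) ≤ 3 * n + 4 := fun S => by
    rw [← h.card_verts]; exact_mod_cast card_le_univ _
  have h4 := hV (Aᶜ \ E)
  have h4' : (0 : ℝ) ≤ #(Aᶜ \ E) := Nat.cast_nonneg _
  have hEV := hV E
  have h5 : ∑ z ∈ Aᶜ \ E, relDeg G X z ≤ #(Aᶜ \ E) * #X := by
    rw [← nsmul_eq_mul]
    exact sum_le_card_nsmul _ _ _ fun z _ => relDeg_le_card G X z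
  have h6 : 0 ≤ ∑ z ∈ Aᶜ \ E, (relDeg G X z ^ 2 - relDeg G X z) :=
    sum_nonneg fun z _ => relDeg_sq_sub_nonneg G X z
  have h7 : 0 ≤ ∑ z ∈ Aᶜ \ E, relDeg G X z :=
    sum_nonneg fun z _ => relDeg_nonneg G X z
  have hα : (0 : ℝ) ≤ n + 1 - #A := by linarith [h.card_le]
  have hE0 : (0 : ℝ) ≤ #E := Nat.cast_nonneg _
  set T := ∑ z ∈ Aᶜ \ E, relDeg G X z
  set Q := ∑ z ∈ Aᶜ \ E, (relDeg G X z ^ 2 - relDeg G X z)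
  clear_value T Q
  obtain ⟨δ, hδ⟩ : ∃ δ : ℝ, δ = n + 1 - #A - #E := ⟨_, rfl⟩
  obtain ⟨x, hx⟩ : ∃ x : ℝ, x = #X := ⟨_, rfl⟩
  have g1 : x * (s + δ) ≤ T := by rw [hδ, hx]; linarith
  have g2 : Q ≤ x * (x * δ) + 2001 * (3 * n + 4) * x := by
    have : (2001 : ℝ) * #E * x ≤ 2001 * (3 * n + 4) * x := by rw [hx]; gcongr
    rw [hδ]; rw [hx] at this ⊢; nlinarith
  have g3 : T ≤ (3 * n + 4) * x := by
    refine h5.trans ?_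
    rw [hx]; gcongr
  have g4 : T ^ 2 ≤ (3 * n + 4) * (Q + T) := h3.trans (by gcongr)
  have g5 : Q + T ≤ x * (x * (δ + 60000)) := by
    have : 3 * n + 4 ≤ 26 * x := by rw [hx]; linarith
    have : (3 * n + 4) * x ≤ 26 * x * x := by rw [← hx] at hp; gcongr
    nlinarith
  rw [← hx] at hp
  suffices 1000 ≤ δ by linarith
  have g6 : 0 ≤ δ + 60000 := by
    have : 0 ≤ x * (x * (δ + 60000)) := by linarith
    have := nonneg_of_mul_nonneg_right this hp
    exact nonneg_of_mul_nonneg_right this hp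
  have g7 : x * (s / 2) ≤ T := by
    refine le_trans ?_ g1
    gcongr; linarith
  have g8 : (x * (s / 2)) ^ 2 ≤ T ^ 2 := by
    have : 0 ≤ s := by linarith
    gcongr
  have g9 : x ^ 2 * (s / 2) ^ 2 ≤ x ^ 2 * ((3 * n + 4) * (δ + 60000)) := by
    have : (3 * n + 4) * (Q + T) ≤ (3 * n + 4) * (x * (x * (δ + 60000))) := by gcongr
    nlinarith
  have g10 := le_of_mul_le_mul_left g9 (by positivity)
  by_contra hcon
  push Not at hcon
  have g11 : (3 * n + 4) * (δ + 60000) ≤ (3 * n + 4) * (61000) := by gcongr; linarith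
  have g12 : (n / (2 * 10 ^ 5) : ℝ) ^ 2 ≤ (s / 2) ^ 2 := by
    have h0 : (n / (2 * 10 ^ 5) : ℝ) ≤ s / 2 := by
      rw [div_le_div_iff₀ (by positivity) (by positivity)]; linarith
    exact pow_le_pow_left₀ (by positivity) h0 2
  nlinarith

end DenseClique
end Counting

section PathBuilding

open Finset
open scoped Classical

variable {V : Type*} {F : SimpleGraph V} {X Y : Finset V} {K w : ℕ}

/-- Removing few vertices of `X` leaves many edges at some vertex of each `K`-subset of `Y`. -/
lemma exists_large_degree_avoiding
    (hB : ∀ Z ⊆ Y, #Z = K → ∀ W : Finset V, #W ≤ w → ∃ b ∈ Z, ∃ x ∈ X \ W, F.Adj x b)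
    {Z W : Finset V} (hZ : Z ⊆ Y) (hZK : #Z = K) (hW : #W + 2 * K ^ 2 ≤ w) :
    ∃ b ∈ Z, 2 * K ≤ #{x ∈ X \ W | F.Adj x b} := by
  by_contra! hcon
  obtain ⟨b, hb, x, hx, hxb⟩ := hB Z hZ hZK
    (W ∪ Z.biUnion fun b => {x ∈ X \ W | F.Adj x b}) (by
      refine (card_union_le _ _).trans ?_
      have : #(Z.biUnion fun b => {x ∈ X \ W | F.Adj x b}) ≤ #Z * (2 * K) :=
        card_biUnion_le_card_mul _ _ _ fun b hb => (hcon b hb).le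
      rw [hZK] at this
      nlinarith)
  rw [mem_sdiff, mem_union, mem_biUnion] at hx
  exact hx.2 (Or.inr ⟨b, hb, mem_filter.2 ⟨mem_sdiff.2 ⟨hx.1, fun h => hx.2 (Or.inl h)⟩, hxb⟩⟩)

/-- In a robustly connected bipartite graph there are paths of every suitable even order that
start in a prescribed large subset of `X` and end in a prescribed large subset of `Y`. -/
lemma exists_path_between (hXY : Disjoint X Y)
    (hA : ∀ S ⊆ X, ∀ T ⊆ X, #S = K → #T = K → ∀ W : Finset V, #W ≤ w →
      ∃ b ∈ Y \ W, (∃ x ∈ S, F.Adj x b) ∧ ∃ x ∈ T, F.Adj x b)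
    (hB : ∀ Z ⊆ Y, #Z = K → ∀ W : Finset V, #W ≤ w → ∃ b ∈ Z, ∃ x ∈ X \ W, F.Adj x b)
    (hK : 0 < K) {Z : Finset V} (hZ : Z ⊆ Y) (hZK : #Z = K) (j : ℕ) :
    ∀ S WX WY : Finset V, S ⊆ X \ WX → K ≤ #S → Disjoint Z WY →
      #WX + j + (2 * K ^ 2 + 2 * K) ≤ w → #WY + j + (2 * K ^ 2 + 2 * K) ≤ w →
      ∃ (l : List V) (hl : l ≠ []), l.IsChain F.Adj ∧ l.Nodup ∧ l.length = 2 * j + 4 ∧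
        (∀ x ∈ l, x ∈ X \ WX ∨ x ∈ Y \ WY) ∧ l.head hl ∈ S ∧ l.getLast hl ∈ Z := by
  induction j with
  | zero =>
    intro S WX WY hS hSK hZW hWX hWY
    obtain ⟨S', hS', hS'K⟩ := exists_subset_card_eq hSK
    obtain ⟨b, hb, hbd⟩ := exists_large_degree_avoiding hB hZ hZK (W := WX ∪ S') (by
      have := card_union_le WX S'; omega)
    obtain ⟨T, hT, hTK⟩ := exists_subset_card_eq (show K ≤ _ by exact le_trans (by omega) hbd)
    have hSX : S ⊆ X := hS.trans sdiff_subset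
    obtain ⟨c, hc, ⟨x, hx, hxc⟩, x', hx', hxc'⟩ := hA S' (hS'.trans hSX) T
      (fun t ht => (mem_sdiff.1 (mem_filter.1 (hT ht)).1).1) hS'K hTK (WY ∪ Z) (by
        have := card_union_le WY Z; omega)
    have hmemx := mem_filter.1 (hT hx')
    simp only [mem_sdiff, mem_union, not_or] at hc hmemx
    have hxS := mem_sdiff.1 (hS (hS' hx))
    have hbY := hZ hb
    have d1 := Finset.disjoint_left.1 hXY hxS.1
    have d2 := Finset.disjoint_left.1 hXY hmemx.1.1
    have n1 : x ≠ x' := fun h => hmemx.1.2.2 (h ▸ hx)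
    have n2 : c ≠ b := fun h => hc.2.2 (h ▸ hb)
    have n3 := Finset.disjoint_left.1 hZW hb
    refine ⟨[x, c, x', b], by simp, ?_, ?_, by simp, ?_, by simpa using hS' hx, by simpa using hb⟩
    · simp [hxc, hxc'.symm, hmemx.2]
    · have a1 : x ≠ c := fun h => d1 (h ▸ hc.1)
      have a2 : x ≠ b := fun h => d1 (h ▸ hbY)
      have a3 : c ≠ x' := fun h => d2 (h ▸ hc.1)
      have a4 : x' ≠ b := fun h => d2 (h ▸ hbY)
      simp [a1, a2, a3, a4, n1, n2]
    · simp only [List.mem_cons, List.not_mem_nil, or_false, mem_sdiff]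
      rintro z (rfl | rfl | rfl | rfl) <;> tauto
  | succ j ih =>
    intro S WX WY hS hSK hZW hWX hWY
    have hSX : S ⊆ X := hS.trans sdiff_subset
    obtain ⟨S', hS', hS'K⟩ := exists_subset_card_eq hSK
    have hY1 : K ≤ #{b ∈ Y \ (WY ∪ Z) | ∃ x ∈ S', F.Adj x b} := by
      by_contra! hcon
      obtain ⟨b, hb, hb', -⟩ := hA S' (hS'.trans hSX) S' (hS'.trans hSX) hS'K hS'K
        (WY ∪ Z ∪ {b ∈ Y \ (WY ∪ Z) | ∃ x ∈ S', F.Adj x b}) (by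
          have h1 := card_union_le (WY ∪ Z) {b ∈ Y \ (WY ∪ Z) | ∃ x ∈ S', F.Adj x b}
          have h2 := card_union_le WY Z
          omega)
      simp only [mem_sdiff, mem_union, mem_filter, not_or] at hb
      exact hb.2.2 ⟨⟨hb.1, hb.2.1⟩, hb'⟩
    obtain ⟨Y1, hY1s, hY1K⟩ := exists_subset_card_eq hY1
    obtain ⟨c, hc, hcd⟩ := exists_large_degree_avoiding hB
      (fun y hy => (mem_sdiff.1 (mem_filter.1 (hY1s hy)).1).1) hY1K (W := WX) (by omega)
    have hc2 := mem_filter.1 (hY1s hc)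
    obtain ⟨hc2, x, hx, hxc⟩ := hc2
    simp only [mem_sdiff, mem_union, not_or] at hc2
    have hxS := mem_sdiff.1 (hS (hS' hx))
    obtain ⟨l, hl, h1, h2, h3, h4, h5, h6⟩ := ih ({x ∈ X \ WX | F.Adj x c}.erase x) (insert x WX)
      (insert c WY)
      (fun z hz => by simp only [mem_erase, mem_filter, mem_sdiff, mem_insert] at hz ⊢; tauto)
      (by have := pred_card_le_card_erase (s := {x ∈ X \ WX | F.Adj x c}) (a := x); omega)
      (by rw [disjoint_insert_right]; exact ⟨hc2.2.2, hZW⟩)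
      (by have := card_insert_le x WX; omega) (by have := card_insert_le c WY; omega)
    have d1 := Finset.disjoint_left.1 hXY hxS.1
    have d2 := Finset.disjoint_right.1 hXY hc2.1
    refine ⟨x :: c :: l, by simp, ?_, ?_, by simp [h3]; ring, ?_, by simpa using hS' hx, ?_⟩
    · obtain ⟨y, l', rfl⟩ := List.exists_cons_of_ne_nil hl
      simp only [List.head_cons, mem_erase, mem_filter] at h5
      rw [List.isChain_cons_cons, List.isChain_cons_cons]
      exact ⟨hxc, h5.2.2.symm, h1⟩
    · have a1 : x ≠ c := fun h => d1 (h ▸ hc2.1)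
      have a2 : x ∉ l := fun h => by
        have := h4 x h; simp only [mem_sdiff, mem_insert] at this; tauto
      have a3 : c ∉ l := fun h => by
        have := h4 c h; simp only [mem_sdiff, mem_insert] at this; tauto
      simp [a1, a2, a3, h2]
    · intro z hz
      simp only [List.mem_cons] at hz
      simp only [mem_sdiff]
      rcases hz with rfl | rfl | hz
      · exact Or.inl hxS
      · exact Or.inr ⟨hc2.1, hc2.2.1⟩
      · have := h4 z hz; simp only [mem_sdiff, mem_insert] at this; tauto
    · rwa [List.getLast_cons (by simp), List.getLast_cons hl]

end PathBuilding

lemma containsCopy_wheelGraph_of_list {V : Type*} {F : SimpleGraph V} {h y : V} {l : List V}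
    (hl : l ≠ []) (hchain : l.IsChain F.Adj) (hnodup : (y :: l).Nodup)
    (hhub : ∀ x ∈ y :: l, F.Adj h x) (hhead : F.Adj y (l.head hl))
    (hlast : F.Adj (l.getLast hl) y) : ContainsCopy F (wheelGraph (l.length + 1)) := by
  have hlen : (y :: l).length = l.length + 1 := rfl
  have hc : (y :: l).IsChain F.Adj := by
    obtain ⟨z, l', rfl⟩ := List.exists_cons_of_ne_nil hl
    exact List.isChain_cons_cons.2 ⟨hhead, hchain⟩
  have key : ∀ i j : Fin (l.length + 1), (SimpleGraph.cycleGraph (l.length + 1)).Adj i j →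
      F.Adj ((y :: l).get i) ((y :: l).get j) := by
    have step : ∀ i j : Fin (l.length + 1), i - j = 1 →
        F.Adj ((y :: l).get j) ((y :: l).get i) := by
      intro i j hij
      have hij' : i = j + 1 := by rw [← hij]; abel
      subst hij'
      rcases Nat.lt_or_ge (j.val + 1) (l.length + 1) with h1 | h1
      · have e : (j + 1 : Fin (l.length + 1)).val = j.val + 1 :=
          Fin.val_add_one_of_lt' h1
        have := List.isChain_iff_getElem.1 hc j.val (by simpa using h1)
        simpa only [List.get_eq_getElem, e] using this
      · have e : j = Fin.last l.length := by
          apply Fin.ext; simp; omega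
        subst e
        have e2 : (Fin.last l.length + 1) = 0 := Fin.last_add_one _
        rw [e2]
        have : (y :: l).get (Fin.last l.length) = l.getLast hl := by
          rw [← List.getLast_cons (a := y) hl, List.getLast_eq_getElem]
          simp
        rw [this]
        simpa using hlast
    intro i j hij
    have hpos := List.length_pos_iff.2 hl
    obtain ⟨k, hk⟩ : ∃ k, l.length = k + 1 := ⟨l.length - 1, by omega⟩
    rw [SimpleGraph.cycleGraph_adj'] at hij
    have one : ((1 : Fin (l.length + 1)).val) = 1 := by
      rw [Fin.val_one']; exact Nat.mod_eq_of_lt (by omega)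
    rcases hij with hij | hij
    · exact (step i j (Fin.ext (by rw [hij, one]))).symm
    · exact step j i (Fin.ext (by rw [hij, one]))
  refine ⟨⟨fun o => o.elim h (y :: l).get, ?_⟩, ?_⟩
  · intro a b hab
    rw [wheelGraph, SimpleGraph.fromRel_adj] at hab
    obtain ⟨hne, hab⟩ := hab
    rcases a with _ | i <;> rcases b with _ | j
    · exact absurd rfl hne
    · exact hhub _ (List.get_mem _ _)
    · exact (hhub _ (List.get_mem _ _)).symm
    · simp only [reduceCtorEq, false_or, Option.some.injEq] at hab
      rcases hab with ⟨i', j', rfl, rfl, h1⟩ | ⟨i', j', rfl, rfl, h1⟩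
      · exact key _ _ h1
      · exact (key _ _ h1).symm
  · rintro (_ | i) (_ | j) hab
    · rfl
    · exact absurd hab (hhub _ (List.get_mem _ _)).ne
    · exact absurd hab.symm (hhub _ (List.get_mem _ _)).ne
    · exact congrArg some (List.nodup_iff_injective_get.1 hnodup hab)

section Numerics

variable {x s : ℝ}

lemma sq_add_one_le (hx : 10 ^ 17 ≤ x) : (x + 1) ^ 2 ≤ 1001 / 1000 * x ^ 2 := by
  nlinarith

lemma sq_mul_le_of_le_half (hx : 10 ^ 17 ≤ x) (hs0 : 0 ≤ s) (hs : 2 * s ≤ x + 1) :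
    (x + 1) ^ 2 * (s + 103) ≤ 348 / 1000 * x ^ 2 * (x + 1 + s) :=
  calc (x + 1) ^ 2 * (s + 103) ≤ 1001 / 1000 * x ^ 2 * (s + 103) := by
        gcongr; exact sq_add_one_le hx
    _ = x ^ 2 * (1001 / 1000 * (s + 103)) := by ring
    _ ≤ x ^ 2 * (348 / 1000 * (x + 1 + s)) := by gcongr ?_ * ?_; linarith
    _ = _ := by ring

lemma sq_mul_le_of_small (hx : 10 ^ 17 ≤ x) (hs0 : 0 ≤ s) (hs : 10 ^ 5 * s < x) :
    (x + 1) ^ 2 * (s + 103) ≤ 1 / 1000 * x ^ 2 * (x + 1 + s) :=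
  calc (x + 1) ^ 2 * (s + 103) ≤ 1001 / 1000 * x ^ 2 * (s + 103) := by
        gcongr; exact sq_add_one_le hx
    _ = x ^ 2 * (1001 / 1000 * (s + 103)) := by ring
    _ ≤ x ^ 2 * (1 / 1000 * (x + 1 + s)) := by gcongr ?_ * ?_; linarith
    _ = _ := by ring

lemma two_mul_sq_lt (hx : 10 ^ 17 ≤ x) (hs0 : 0 ≤ s) :
    2 * ((x + 1) ^ 2 * (s + 103)) < (62 / 100 * x + s) ^ 2 * (x + 1 + s) := by
  have hx0 : 0 < x := by linarith
  have h1 : 2 * ((x + 1) ^ 2 * (s + 103)) ≤ 2 * (1001 / 1000 * x ^ 2 * (s + 103)) := by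
    gcongr; exact sq_add_one_le hx
  have h2 : 0 ≤ x * (244 / 10000 * x ^ 2 - 3776 / 10000 * x * s + 224 / 100 * s ^ 2) := by
    apply mul_nonneg hx0.le
    nlinarith [sq_nonneg (x - 4 * s), sq_nonneg (x - 8 * s), sq_nonneg (x - 7 * s)]
  have h3 : 207 * x ^ 2 < 36 / 100 * x ^ 2 * x := by nlinarith [sq_pos_of_pos hx0]
  have h4 : 0 ≤ s ^ 3 := by positivity
  have h5 : 0 ≤ (62 / 100 * x + s) ^ 2 := by positivity
  nlinarith

/-- Bounds on two relative degrees whose squares have a small sum. -/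
lemma bounds_of_sq_add_sq {a b : ℝ} (hx : 10 ^ 17 ≤ x) (hs0 : 0 ≤ s) (hs : 2 * s ≤ x + 1)
    (hab : (a ^ 2 + b ^ 2) * (x + 1 + s) ≤ (x + 1) ^ 2 * (s + 103)) :
    a ≤ 59 / 100 * x ∧ b ≤ 59 / 100 * x ∧ a + b ≤ 62 / 100 * x + s := by
  have hx0 : 0 < x := by linarith
  have h1 : a ^ 2 + b ^ 2 ≤ 348 / 1000 * x ^ 2 :=
    le_of_mul_le_mul_right (hab.trans (sq_mul_le_of_le_half hx hs0 hs)) (by positivity)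
  refine ⟨abs_le_of_sq_le_sq' ?_ (by positivity) |>.2,
    abs_le_of_sq_le_sq' ?_ (by positivity) |>.2, ?_⟩
  · nlinarith
  · nlinarith
  · by_contra! hcon
    have h2 : (62 / 100 * x + s) ^ 2 ≤ (a + b) ^ 2 := by gcongr
    have h3 : (62 / 100 * x + s) ^ 2 ≤ 2 * (a ^ 2 + b ^ 2) := by nlinarith [sq_nonneg (a - b)]
    have h4 := mul_le_mul_of_nonneg_right h3 (by positivity : 0 ≤ x + 1 + s)
    linarith [two_mul_sq_lt hx hs0]

lemma bounds_of_sq_add_sq_of_small {a b : ℝ} (hx : 10 ^ 17 ≤ x) (hs0 : 0 ≤ s)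
    (hs : 10 ^ 5 * s < x) (hab : (a ^ 2 + b ^ 2) * (x + 1 + s) ≤ (x + 1) ^ 2 * (s + 103)) :
    a ≤ 5 / 100 * x ∧ b ≤ 5 / 100 * x := by
  have hx0 : 0 < x := by linarith
  have h1 : a ^ 2 + b ^ 2 ≤ 1 / 1000 * x ^ 2 :=
    le_of_mul_le_mul_right (hab.trans (sq_mul_le_of_small hx hs0 hs)) (by positivity)
  refine ⟨abs_le_of_sq_le_sq' ?_ (by positivity) |>.2, abs_le_of_sq_le_sq' ?_ (by positivity) |>.2⟩
  · nlinarith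
  · nlinarith

end Numerics

section Neighbourhood

open Finset
open scoped Classical

variable {V : Type*} [Fintype V]

/-- The non-neighbours of `v` are covered by two dense cliques `A` and `B` and a small
exceptional set `R` of vertices with few non-neighbours in `A ∪ B`. -/
structure TwoCliqueCover (G : SimpleGraph V) (n s : ℕ) (v : V) (A B R : Finset V) : Prop where
  left : DenseClique G n s A
  right : DenseClique G n s B
  disjoint_left_right : Disjoint A B
  disjoint_left : Disjoint A R
  disjoint_right : Disjoint B R
  not_adj_left : ∀ x ∈ A, ¬ G.Adj v x
  not_adj_right : ∀ x ∈ B, ¬ G.Adj v x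
  not_adj_rest : ∀ x ∈ R, ¬ G.Adj v x
  card_add : #A + #B + #R + s = 2 * n + 2
  card_adj : #{u | G.Adj v u} = n + 1 + s
  two_mul_le : 2 * s ≤ n + 1
  card_rest : #R ≤ 100
  rest_deg : ∀ w ∈ R, ((#{x ∈ A | ¬ G.Adj w x} : ℕ) : ℝ) + (#{x ∈ B | ¬ G.Adj w x} : ℕ)
    ≤ (n + 1) / 3 + 1

namespace TwoCliqueCover

variable {G : SimpleGraph V} {n s j : ℕ} {v y : V} {A B R : Finset V}

lemma symm (h : TwoCliqueCover G n s v A B R) : TwoCliqueCover G n s v B A R where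
  left := h.right
  right := h.left
  disjoint_left_right := h.disjoint_left_right.symm
  disjoint_left := h.disjoint_right
  disjoint_right := h.disjoint_left
  not_adj_left := h.not_adj_right
  not_adj_right := h.not_adj_left
  not_adj_rest := h.not_adj_rest
  card_add := by have := h.card_add; omega
  card_adj := h.card_adj
  two_mul_le := h.two_mul_le
  card_rest := h.card_rest
  rest_deg := fun w hw => by rw [add_comm]; exact h.rest_deg w hw

lemma deficit_add (h : TwoCliqueCover G n s v A B R) :
    ((n : ℝ) + 1 - #A) + (n + 1 - #B) = s + #R := by
  have : (#A : ℝ) + #B + #R + s = 2 * n + 2 := by exact_mod_cast h.card_add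
  linarith

lemma common_left (h : TwoCliqueCover G n s v A B R) (hn : 10 ^ 17 ≤ n) {S M : Finset V}
    (hS : S ⊆ A) (hK : #S = 1000) (hM : M ⊆ Aᶜ) (hMS : ∀ u ∈ M, ∀ x ∈ S, G.Adj u x) :
    (#M : ℝ) ≤ 28 / 100 * n + #R - (n + 1 - #B) := by
  have h1 := h.left.card_common_le (by omega) (Nat.cast_nonneg s)
    (by exact_mod_cast h.two_mul_le) hS hK hM hMS
  have := h.deficit_add
  linarith

lemma deficit_right_le (h : TwoCliqueCover G n s v A B R) (hn : 10 ^ 17 ≤ n) :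
    ((n : ℝ) + 1 - #B) ≤ 28 / 100 * n + #R := by
  have h1 := h.right.card_le
  have h2 := h.card_add
  have h3 := h.card_rest
  have h4 := h.two_mul_le
  have h5 : #B ≤ n + 1 := by exact_mod_cast h1
  obtain ⟨S, hS, hK⟩ := exists_subset_card_eq (show 1000 ≤ #A by omega)
  have := h.common_left hn hS hK (empty_subset _) (by simp)
  simp only [card_empty, Nat.cast_zero] at this
  linarith

/-- A vertex `y` whose neighbours do not meet the cliques too often, together with a further
vertex attached to both cliques, is the start of an odd wheel in the complement. -/
lemma few_attached (h : TwoCliqueCover G n s v A B R) (hn : 10 ^ 17 ≤ n)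
    (hj : 4 * (2 * j + 5) ≤ n) (hW : ¬ ContainsCopy Gᶜ (wheelGraph (2 * j + 5)))
    (hy : G.Adj v y) (hyA : relDeg G A y ≤ 59 / 100 * n)
    (hyB : relDeg G B y ≤ 31 / 100 * n + (n + 1 - #B)) {u : V} (hu : G.Adj v u)
    (hyu : Gᶜ.Adj y u) :
    #{x ∈ {x ∈ A | ¬ G.Adj y x} | ¬ G.Adj u x} < 1000 ∨
      #{x ∈ {x ∈ B | ¬ G.Adj y x} | ¬ G.Adj u x} < 1000 := by
  by_contra! hcon
  obtain ⟨hS, hT⟩ := hcon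
  set X := {x ∈ A | ¬ G.Adj y x} with hXdef
  set Y := {x ∈ B | ¬ G.Adj y x} with hYdef
  have hXA : X ⊆ A := filter_subset _ _
  have hYB : Y ⊆ B := filter_subset _ _
  have hXY : Disjoint X Y := disjoint_of_subset_left hXA
    (disjoint_of_subset_right hYB h.disjoint_left_right)
  have hne : ∀ x ∈ X, ∀ b ∈ Y, x ≠ b := fun x hx b hb hxb =>
    Finset.disjoint_left.1 hXY hx (hxb ▸ hb)
  have cX := relDeg_add_not G A y
  have cY := relDeg_add_not G B y
  rw [← hXdef] at cX
  rw [← hYdef] at cY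
  have hnR : (10 : ℝ) ^ 17 ≤ n := by exact_mod_cast hn
  have hr : (#R : ℝ) ≤ 100 := by exact_mod_cast h.card_rest
  have hdef := h.deficit_add
  have hw : ((n / 8 + 3000000 : ℕ) : ℝ) ≤ n / 8 + 3000000 := by
    push_cast
    gcongr
    exact Nat.cast_div_le
  have hle : ∀ P W : Finset V, #W ≤ n / 8 + 3000000 → (#P : ℝ) - (n / 8 + 3000000) ≤ #(P \ W) := by
    intro P W hWw
    have h1 : #P ≤ #(P \ W) + #W := by
      have := le_card_sdiff W P; omega
    have h1' : (#P : ℝ) ≤ #(P \ W) + #W := by exact_mod_cast h1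
    have h2 : (#W : ℝ) ≤ (n / 8 + 3000000 : ℕ) := by exact_mod_cast hWw
    linarith
  obtain ⟨Z, hZ, hZK⟩ := exists_subset_card_eq hT
  obtain ⟨l, hl, h1, h2, h3, h4, h5, h6⟩ := exists_path_between (F := Gᶜ) (X := X) (Y := Y)
    (K := 1000) (w := n / 8 + 3000000) hXY (by
      intro S hSX T hTX hSK hTK W hWw
      by_contra! hcon
      obtain ⟨M, M', hM, hM', hMS, hMT, hsub⟩ : ∃ M M' : Finset V, M ⊆ Y ∧ M' ⊆ Y ∧
          (∀ b ∈ M, ∀ x ∈ S, G.Adj b x) ∧ (∀ b ∈ M', ∀ x ∈ T, G.Adj b x) ∧ Y \ W ⊆ M ∪ M' := by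
        refine ⟨{b ∈ Y | ∀ x ∈ S, G.Adj b x}, {b ∈ Y | ∀ x ∈ T, G.Adj b x}, filter_subset _ _,
          filter_subset _ _, fun b hb => (mem_filter.1 hb).2, fun b hb => (mem_filter.1 hb).2, ?_⟩
        intro b hb
        have hbY := (mem_sdiff.1 hb).1
        by_cases hbS : ∃ x ∈ S, Gᶜ.Adj x b
        · refine mem_union_right _ (mem_filter.2 ⟨hbY, fun x hx => ?_⟩)
          have := hcon b hb hbS x hx
          rw [compl_adj, not_and, not_not] at this
          exact (this (hne x (hTX hx) b hbY)).symm
        · push Not at hbS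
          refine mem_union_left _ (mem_filter.2 ⟨hbY, fun x hx => ?_⟩)
          have := hbS x hx
          rw [compl_adj, not_and, not_not] at this
          exact (this (hne x (hSX hx) b hbY)).symm
      have hYc : Y ⊆ Aᶜ := fun b hb =>
        mem_compl.2 fun hbA => Finset.disjoint_left.1 h.disjoint_left_right hbA (hYB hb)
      have i1 := h.common_left hn (hSX.trans hXA) hSK (hM.trans hYc) hMS
      have i2 := h.common_left hn (hTX.trans hXA) hTK (hM'.trans hYc) hMT
      have i3 := (card_le_card hsub).trans (card_union_le _ _)
      have i4 : (#(Y \ W) : ℝ) ≤ #M + #M' := by exact_mod_cast i3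
      have i5 := hle Y W hWw
      linarith) (by
      intro Z hZ hZK W hWw
      by_contra! hcon
      have i1 := h.symm.common_left hn (hZ.trans hYB) hZK (M := X \ W)
        (fun x hx => mem_compl.2 fun hxB => Finset.disjoint_left.1 h.disjoint_left_right
          (hXA (mem_sdiff.1 hx).1) hxB)
        (fun x hx b hb => by
          have := hcon b hb x hx
          rw [compl_adj, not_and, not_not] at this
          exact this (hne x (mem_sdiff.1 hx).1 b (hZ hb)))
      have i5 := hle X W hWw
      linarith) (by norm_num) (hZ.trans (filter_subset _ _)) hZK j
      {x ∈ X | ¬ G.Adj u x} ∅ ∅ (by rw [sdiff_empty]; exact filter_subset _ _) hS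
      (disjoint_empty_right _) (by rw [card_empty]; omega) (by rw [card_empty]; omega)
  have hout : ∀ w, G.Adj v w → ∀ x ∈ l, w ≠ x := by
    rintro w hw x hx rfl
    rcases h4 w hx with h7 | h7
    · exact h.not_adj_left w (hXA (mem_sdiff.1 h7).1) hw
    · exact h.not_adj_right w (hYB (mem_sdiff.1 h7).1) hw
  apply hW
  have := containsCopy_wheelGraph_of_list (F := Gᶜ) (h := y) (y := u) hl h1
    (List.nodup_cons.2 ⟨fun hul => hout u hu u hul rfl, h2⟩)
    (by
      intro x hx
      rcases List.mem_cons.1 hx with rfl | hx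
      · exact hyu
      · rw [compl_adj]
        refine ⟨hout y hy x hx, ?_⟩
        rcases h4 x hx with h7 | h7
        · exact (mem_filter.1 (mem_sdiff.1 h7).1).2
        · exact (mem_filter.1 (mem_sdiff.1 h7).1).2)
    ((compl_adj _ _ _).2 ⟨hout u hu _ (List.head_mem hl), (mem_filter.1 h5).2⟩)
    ((compl_adj _ _ _).2 ⟨hout u hu _ (List.getLast_mem hl), (mem_filter.1 (hZ h6)).2⟩).symm
  rwa [h3] at this

/-- Some neighbour of `v` has few neighbours in both cliques. -/
lemma exists_small_relDeg (h : TwoCliqueCover G n s v A B R) (hn : 10 ^ 17 ≤ n) :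
    ∃ y, G.Adj v y ∧
      (relDeg G A y ^ 2 + relDeg G B y ^ 2) * (n + 1 + s) ≤ (n + 1) ^ 2 * (s + 103) := by
  have hnR : (10 : ℝ) ^ 17 ≤ n := by exact_mod_cast hn
  have hr : (#R : ℝ) ≤ 100 := by exact_mod_cast h.card_rest
  have hs : (2 : ℝ) * s ≤ n + 1 := by exact_mod_cast h.two_mul_le
  have hs0 : (0 : ℝ) ≤ s := Nat.cast_nonneg s
  have hU : (#{u | G.Adj v u} : ℝ) = n + 1 + s := by exact_mod_cast h.card_adj
  have key : ∀ P : Finset V, DenseClique G n s P → (∀ x ∈ P, ¬ G.Adj v x) →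
      ∑ u ∈ {u | G.Adj v u}, relDeg G P u ^ 2
        ≤ (n + 1) ^ 2 * (n + 1 - #P) + (n + 1 + s) * (n + 1) := by
    intro P hP hPv
    have h1 := hP.sum_sq_sub_le (Subset.refl P)
    have h2 : ∑ u ∈ {u | G.Adj v u}, (relDeg G P u ^ 2 - relDeg G P u)
        ≤ ∑ u ∈ Pᶜ, (relDeg G P u ^ 2 - relDeg G P u) :=
      sum_le_sum_of_subset_of_nonneg
        (fun u hu => mem_compl.2 fun huP => hPv u huP (mem_filter.1 hu).2)
        fun z _ _ => relDeg_sq_sub_nonneg G P z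
    have h3 : ∑ u ∈ {u | G.Adj v u}, relDeg G P u ≤ (n + 1 + s) * (n + 1) := by
      rw [← hU, ← nsmul_eq_mul]
      exact sum_le_card_nsmul _ _ _ fun z _ => (relDeg_le_card G P z).trans hP.card_le
    rw [sum_sub_distrib] at h2
    have h4 := hP.card_le
    have h5 : (#P : ℝ) * (#P - 1) ≤ (n + 1) ^ 2 := by
      have : (0 : ℝ) ≤ #P := Nat.cast_nonneg _
      nlinarith
    have h6 : (#P : ℝ) * (#P - 1) * (n + 1 - #P) ≤ (n + 1) ^ 2 * (n + 1 - #P) := by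
      gcongr
    linarith
  have hA := key A h.left h.not_adj_left
  have hB := key B h.right h.not_adj_right
  by_contra! hcon
  have hne : ({u | G.Adj v u} : Finset V).Nonempty := by
    rw [← card_pos, h.card_adj]; omega
  have h1 : ∑ u ∈ {u | G.Adj v u}, ((n + 1) ^ 2 * (s + 103) : ℝ)
      < ∑ u ∈ {u | G.Adj v u}, (relDeg G A u ^ 2 + relDeg G B u ^ 2) * (n + 1 + s) :=
    sum_lt_sum_of_nonempty hne fun u hu => hcon u (mem_filter.1 hu).2
  rw [sum_const, nsmul_eq_mul, hU, ← sum_mul, sum_add_distrib, mul_comm] at h1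
  have h2 := lt_of_mul_lt_mul_right h1 (by positivity)
  have hd := h.deficit_add
  have h3 : ((n : ℝ) + 1) ^ 2 * (n + 1 - #A) + (n + 1) ^ 2 * (n + 1 - #B)
      ≤ (n + 1) ^ 2 * (s + 100) := by
    rw [← mul_add, hd]; gcongr
  nlinarith

lemma card_not_adj_ge (h : TwoCliqueCover G n s v A B R) (hy : G.Adj v y) :
    s + 1 ≤ #{u | G.Adj v u ∧ Gᶜ.Adj y u} := by
  have h1 := h.left.codeg v y hy.ne
  have h2 : (univ.filter fun u => G.Adj v u) ⊆ (univ.filter fun u => G.Adj v u ∧ Gᶜ.Adj y u)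
      ∪ (univ.filter fun z => G.Adj z v ∧ G.Adj z y) ∪ {y} := by
    intro u hu
    simp only [mem_union, mem_filter, mem_univ, true_and, mem_singleton, compl_adj] at hu ⊢
    rw [G.adj_comm u v, G.adj_comm u y, eq_comm (a := u)]
    tauto
  have h3 := card_le_card h2
  have h4 := card_union_le ((univ.filter fun u => G.Adj v u ∧ Gᶜ.Adj y u)
      ∪ (univ.filter fun z => G.Adj z v ∧ G.Adj z y)) {y}
  have h5 := card_union_le (univ.filter fun u => G.Adj v u ∧ Gᶜ.Adj y u)
    (univ.filter fun z => G.Adj z v ∧ G.Adj z y)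
  rw [h.card_adj] at h3
  rw [card_singleton] at h4
  have h6 : #{z | G.Adj z v ∧ G.Adj z y} + 1 ≤ n := by
    have : (#{z | G.Adj z v ∧ G.Adj z y} : ℝ) + 1 ≤ n := by linarith
    exact_mod_cast this
  omega

/-- If `s` is small, few vertices can be attached to large subsets of both cliques. -/
lemma sum_attached_lt (h : TwoCliqueCover G n s v A B R) (hn : 10 ^ 17 ≤ n)
    (hs : 10 ^ 5 * (s : ℝ) < n) {X Y P Q : Finset V} (hX : X ⊆ A) (hY : Y ⊆ B)
    (hXn : 90 / 100 * (n : ℝ) ≤ #X) (hYn : 90 / 100 * (n : ℝ) ≤ #Y)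
    (hP : ∀ u ∈ P, G.Adj v u ∧ #{x ∈ X | ¬ G.Adj u x} < 1000)
    (hQ : ∀ u ∈ Q, G.Adj v u ∧ #{x ∈ Y | ¬ G.Adj u x} < 1000) : #P + #Q ≠ s + 1 := by
  intro hPQ
  have hnR : (10 : ℝ) ^ 17 ≤ n := by exact_mod_cast hn
  have hPQ' : (#P : ℝ) + #Q = s + 1 := by exact_mod_cast hPQ
  have key : ∀ C X P : Finset V, DenseClique G n s C → (∀ x ∈ C, ¬ G.Adj v x) → Disjoint C R →
      X ⊆ C → 90 / 100 * (n : ℝ) ≤ #X →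
      (∀ u ∈ P, G.Adj v u ∧ #{x ∈ X | ¬ G.Adj u x} < 1000) →
      90 / 100 * (n : ℝ) * (#P + #R - (n + 1 - #C))
        ≤ 2001 * #P + 2 * (∑ w ∈ R, (#{x ∈ C | ¬ G.Adj w x} : ℝ)) + #R := by
    intro C X P hC hCv hCR hXC hXn hP
    have hp : 0 < #X := by
      have : (0 : ℝ) < #X := by linarith
      exact_mod_cast this
    have hdis : Disjoint P R := Finset.disjoint_left.2 fun u hu hu' =>
      h.not_adj_rest u hu' (hP u hu).1
    have h1 := hC.sum_card_sub_le hXC hp (E := P ∪ R) (fun u hu => by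
      rw [mem_compl]
      intro huC
      rcases mem_union.1 hu with hu | hu
      · exact hCv u huC (hP u hu).1
      · exact Finset.disjoint_left.1 hCR huC hu)
    rw [sum_union hdis] at h1
    have h2 : #P * ((#X : ℝ) - 2001)
        ≤ ∑ u ∈ P, ((#X : ℝ) - 2 * #{x ∈ X | ¬ G.Adj u x} - 1) := by
      rw [← nsmul_eq_mul]
      refine card_nsmul_le_sum _ _ _ fun u hu => ?_
      have : (#{x ∈ X | ¬ G.Adj u x} : ℝ) ≤ 1000 := by exact_mod_cast (hP u hu).2.le
      linarith
    have h3 : #R * ((#X : ℝ) - 1) - 2 * (∑ w ∈ R, (#{x ∈ C | ¬ G.Adj w x} : ℝ))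
        ≤ ∑ u ∈ R, ((#X : ℝ) - 2 * #{x ∈ X | ¬ G.Adj u x} - 1) := by
      rw [← nsmul_eq_mul, ← sum_const, mul_sum, ← sum_sub_distrib]
      refine sum_le_sum fun w _ => ?_
      have : #{x ∈ X | ¬ G.Adj w x} ≤ #{x ∈ C | ¬ G.Adj w x} :=
        card_le_card (filter_subset_filter _ hXC)
      have : (#{x ∈ X | ¬ G.Adj w x} : ℝ) ≤ #{x ∈ C | ¬ G.Adj w x} := by exact_mod_cast this
      linarith
    have h4 : (#X : ℝ) * (#P + #R - (n + 1 - #C))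
        ≤ 2001 * #P + 2 * (∑ w ∈ R, (#{x ∈ C | ¬ G.Adj w x} : ℝ)) + #R := by linarith
    rcases le_or_gt 0 ((#P : ℝ) + #R - (n + 1 - #C)) with h5 | h5
    · exact (mul_le_mul_of_nonneg_right hXn h5).trans h4
    · have h6 : (0 : ℝ) ≤ ∑ w ∈ R, (#{x ∈ C | ¬ G.Adj w x} : ℝ) :=
        sum_nonneg fun _ _ => Nat.cast_nonneg _
      have h7 : 90 / 100 * (n : ℝ) * (#P + #R - (n + 1 - #C)) ≤ 0 :=
        mul_nonpos_of_nonneg_of_nonpos (by positivity) h5.le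
      have : (0 : ℝ) ≤ 2001 * #P + #R := by positivity
      linarith
  have kA := key A X P h.left h.not_adj_left h.disjoint_left hX hXn hP
  have kB := key B Y Q h.right h.not_adj_right h.disjoint_right hY hYn hQ
  have hR : ∑ w ∈ R, (#{x ∈ A | ¬ G.Adj w x} : ℝ) + ∑ w ∈ R, (#{x ∈ B | ¬ G.Adj w x} : ℝ)
      ≤ #R * ((n + 1) / 3 + 1) := by
    rw [← sum_add_distrib, ← nsmul_eq_mul]
    exact sum_le_card_nsmul _ _ _ h.rest_deg
  have hd := h.deficit_add
  have k : 90 / 100 * (n : ℝ) * (1 + #R)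
      ≤ 2001 * (s + 1) + 2 * (#R * ((n + 1) / 3 + 1)) + 2 * #R := by
    have : 90 / 100 * (n : ℝ) * (1 + #R) = 90 / 100 * (n : ℝ) * (#P + #R - (n + 1 - #A))
      + 90 / 100 * (n : ℝ) * (#Q + #R - (n + 1 - #B)) := by
      rw [← mul_add]; congr 1; linarith
    linarith
  have : 0 ≤ (#R : ℝ) * (n - 1000) := mul_nonneg (Nat.cast_nonneg _) (by linarith)
  nlinarith

/-- If `s` is large, few vertices can be attached to large subsets of both cliques. -/
lemma card_attached_add_lt (h : TwoCliqueCover G n s v A B R) (hn : 10 ^ 17 ≤ n)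
    (hs : (n : ℝ) ≤ 10 ^ 5 * s) {X Y P Q : Finset V} (hX : X ⊆ A) (hY : Y ⊆ B)
    (hXn : 12 / 100 * (n : ℝ) ≤ #X) (hYn : 12 / 100 * (n : ℝ) ≤ #Y)
    (hP : ∀ u ∈ P, G.Adj v u ∧ #{x ∈ X | ¬ G.Adj u x} < 1000)
    (hQ : ∀ u ∈ Q, G.Adj v u ∧ #{x ∈ Y | ¬ G.Adj u x} < 1000) : #P + #Q ≠ s + 1 := by
  intro hPQ
  have hPQ' : (#P : ℝ) + #Q = s + 1 := by exact_mod_cast hPQ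
  have hr : (#R : ℝ) ≤ 100 := by exact_mod_cast h.card_rest
  have hd := h.deficit_add
  have h1 := h.left.card_attached_le hn hs hX hXn (E := P)
    (fun u hu => mem_compl.2 fun huA => h.not_adj_left u huA (hP u hu).1)
    (fun u hu => (hP u hu).2.le)
  have h2 := h.right.card_attached_le hn hs hY hYn (E := Q)
    (fun u hu => mem_compl.2 fun huA => h.not_adj_right u huA (hQ u hu).1)
    (fun u hu => (hQ u hu).2.le)
  linarith

theorem containsCopy_wheelGraph (h : TwoCliqueCover G n s v A B R) (hn : 10 ^ 17 ≤ n)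
    (hj : 4 * (2 * j + 5) ≤ n) : ContainsCopy Gᶜ (wheelGraph (2 * j + 5)) := by
  by_contra hW
  have hnR : (10 : ℝ) ^ 17 ≤ n := by exact_mod_cast hn
  have hr : (#R : ℝ) ≤ 100 := by exact_mod_cast h.card_rest
  have hs2 : (2 : ℝ) * s ≤ n + 1 := by exact_mod_cast h.two_mul_le
  have hs0 : (0 : ℝ) ≤ s := Nat.cast_nonneg s
  have hd := h.deficit_add
  have hA1 := h.left.card_le
  have hB1 := h.right.card_le
  have hA2 := h.symm.deficit_right_le hn
  have hB2 := h.deficit_right_le hn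
  obtain ⟨y, hy, hy2⟩ := h.exists_small_relDeg hn
  have cX := relDeg_add_not G A y
  have cY := relDeg_add_not G B y
  obtain ⟨ha, hb, hsum⟩ := bounds_of_sq_add_sq hnR hs0 hs2 hy2
  have hfew : ∀ u, G.Adj v u ∧ Gᶜ.Adj y u → #{x ∈ {x ∈ A | ¬ G.Adj y x} | ¬ G.Adj u x} < 1000 ∨
      #{x ∈ {x ∈ B | ¬ G.Adj y x} | ¬ G.Adj u x} < 1000 := by
    rintro u ⟨hu, hyu⟩
    rcases le_or_gt (relDeg G B y) (31 / 100 * n + (n + 1 - #B)) with hb' | hb'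
    · exact h.few_attached hn hj hW hy ha hb' hu hyu
    · exact (h.symm.few_attached hn hj hW hy hb (by linarith) hu hyu).symm
  obtain ⟨E, hE, hEs⟩ := exists_subset_card_eq (h.card_not_adj_ge hy)
  have hE' : ∀ u ∈ E, G.Adj v u ∧ Gᶜ.Adj y u := fun u hu => (mem_filter.1 (hE hu)).2
  set X := {x ∈ A | ¬ G.Adj y x}
  set Y := {x ∈ B | ¬ G.Adj y x}
  have hX : X ⊆ A := filter_subset _ _
  have hY : Y ⊆ B := filter_subset _ _
  have hcard := card_filter_add_card_filter_not (s := E)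
    (fun u => #{x ∈ X | ¬ G.Adj u x} < 1000)
  rw [hEs] at hcard
  have hP : ∀ u ∈ {u ∈ E | #{x ∈ X | ¬ G.Adj u x} < 1000},
      G.Adj v u ∧ #{x ∈ X | ¬ G.Adj u x} < 1000 := fun u hu =>
    ⟨(hE' u (mem_filter.1 hu).1).1, (mem_filter.1 hu).2⟩
  have hQ : ∀ u ∈ {u ∈ E | ¬ #{x ∈ X | ¬ G.Adj u x} < 1000},
      G.Adj v u ∧ #{x ∈ Y | ¬ G.Adj u x} < 1000 := fun u hu =>
    ⟨(hE' u (mem_filter.1 hu).1).1,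
      (hfew u (hE' u (mem_filter.1 hu).1)).resolve_left (mem_filter.1 hu).2⟩
  rcases le_or_gt (n : ℝ) (10 ^ 5 * s) with hs | hs
  · exact h.card_attached_add_lt hn hs hX hY (by linarith) (by linarith) hP hQ hcard
  · obtain ⟨ha', hb'⟩ := bounds_of_sq_add_sq_of_small hnR hs0 hs hy2
    exact h.sum_attached_lt hn hs hX hY (by linarith) (by linarith) hP hQ hcard

end TwoCliqueCover

lemma containsCopy_completeBipartiteGraph {G : SimpleGraph V} {n : ℕ} {x y : V} (hxy : x ≠ y)
    (h : n ≤ #{z | G.Adj z x ∧ G.Adj z y}) :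
    ContainsCopy G (completeBipartiteGraph (Fin 2) (Fin n)) := by
  obtain ⟨S, hS, hSn⟩ := exists_subset_card_eq h
  let e : Fin n ≃ S := (Fin.castOrderIso hSn.symm).toEquiv.trans S.equivFin.symm
  have he : ∀ i, G.Adj (e i) x ∧ G.Adj (e i) y := fun i => (mem_filter.1 (hS (e i).2)).2
  have hadj : ∀ k i, G.Adj (![x, y] k) (e i) := by
    intro k i
    fin_cases k
    · exact (he i).1.symm
    · exact (he i).2.symm
  refine ⟨⟨Sum.elim ![x, y] (fun i => (e i : V)), ?_⟩, ?_⟩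
  · rintro (k | i) (k' | i') hab
    · simp at hab
    · exact hadj _ _
    · exact (hadj _ _).symm
    · simp at hab
  · apply Function.Injective.sumElim
    · intro k k' hk
      fin_cases k <;> fin_cases k' <;> simp_all [eq_comm]
    · exact Subtype.val_injective.comp e.injective
    · exact fun k i => (hadj k i).ne

/-- Few vertices of `N` have few non-neighbours in `N`. -/
lemma card_le_of_few_not_adj {G : SimpleGraph V} {n : ℕ} (hn : 10 ^ 17 ≤ n)
    (hcodeg : ∀ x y, x ≠ y → (#{z | G.Adj z x ∧ G.Adj z y} : ℝ) ≤ n - 1) {N R : Finset V}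
    (hN : 3 / 2 * ((n : ℝ) + 1) ≤ #N)
    (hR : ∀ w ∈ R, (#{x ∈ N | ¬ G.Adj w x} : ℝ) ≤ #N / 6 + 2) : #R ≤ 100 := by
  have hnR : (10 : ℝ) ^ 17 ≤ n := by exact_mod_cast hn
  by_contra! hcon
  obtain ⟨S, hS, hSc⟩ := exists_subset_card_eq (show 101 ≤ #R by omega)
  have hSR : (#S : ℝ) = 101 := by exact_mod_cast hSc
  have h1 := sum_relDeg_sq_sub_le (G := G) (S := S) (Z := N) (c := n - 1) fun x _ y _ hxy => by
    refine le_trans ?_ (hcodeg x y hxy)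
    have : #{z ∈ N | G.Adj z x ∧ G.Adj z y} ≤ #{z | G.Adj z x ∧ G.Adj z y} :=
      card_le_card (filter_subset_filter _ (subset_univ _))
    exact_mod_cast this
  have h2 := sum_relDeg_sq_le (G := G) (S := S) (Z := N)
  have h3 : #S * (5 / 6 * (#N : ℝ) - 2) ≤ ∑ z ∈ N, relDeg G S z := by
    rw [sum_relDeg_comm, ← nsmul_eq_mul]
    refine card_nsmul_le_sum _ _ _ fun w hw => ?_
    have := relDeg_add_not G N w
    have := hR w (hS hw)
    linarith
  have h4 : ∑ z ∈ N, relDeg G S z ≤ #N * 101 := by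
    rw [← nsmul_eq_mul]
    exact sum_le_card_nsmul _ _ _ fun z _ => (relDeg_le_card G S z).trans_eq hSR
  rw [hSR] at h1 h3
  set T := ∑ z ∈ N, relDeg G S z
  set d : ℝ := (#N : ℝ)
  have h5 : (101 * (5 / 6 * d - 2)) ^ 2 ≤ T ^ 2 := pow_le_pow_left₀ (by linarith) h3 2
  have h6 : T ^ 2 ≤ d * (101 * (101 - 1) * (n - 1) + d * 101) :=
    h2.trans (by gcongr)
  have h7 : d * (101 * (101 - 1) * (n - 1) + d * 101) ≤ d * (6835 * d) := by
    apply mul_le_mul_of_nonneg_left <;> linarith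
  nlinarith

/-- If the vertices of the non-neighbourhood of `v` with many non-neighbours there induce a
bipartite graph in the complement, they form two dense cliques. -/
lemma exists_twoCliqueCover {G : SimpleGraph V} {n s : ℕ} {v : V} (hn : 10 ^ 17 ≤ n)
    (hV : Fintype.card V = 3 * n + 4)
    (hcodeg : ∀ x y, x ≠ y → (#{z | G.Adj z x ∧ G.Adj z y} : ℝ) ≤ n - 1)
    (hv : #{u | G.Adj v u} = n + 1 + s) (hmin : ∀ w, n + 1 + s ≤ #{u | G.Adj w u})
    (hs : 2 * s ≤ n + 1) {D : Set V}
    (hD : ∀ x y, Gᶜ.Adj v x → Gᶜ.Adj v y →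
      (2 * (n : ℝ) + 2 - s) / 6 + 1 ≤ #{z | Gᶜ.Adj x z ∧ Gᶜ.Adj v z} →
      (2 * (n : ℝ) + 2 - s) / 6 + 1 ≤ #{z | Gᶜ.Adj y z ∧ Gᶜ.Adj v z} →
      Gᶜ.Adj x y → (x ∈ D ↔ y ∉ D)) :
    ∃ A B R, TwoCliqueCover G n s v A B R := by
  obtain ⟨N, hNdef⟩ : ∃ N : Finset V, N = univ.filter fun x => Gᶜ.Adj v x := ⟨_, rfl⟩
  have hN : ∀ x, x ∈ N ↔ Gᶜ.Adj v x := by simp [hNdef]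
  have hNv : ∀ x ∈ N, ¬ G.Adj v x := fun x hx => ((compl_adj _ _ _).1 ((hN x).1 hx)).2
  have hNcard : #N + s = 2 * n + 2 := by
    have h1 : insert v N = univ.filter fun x => ¬ G.Adj v x := by
      ext x
      simp only [mem_insert, hN, compl_adj, mem_filter, mem_univ, true_and]
      constructor
      · rintro (rfl | h)
        · exact G.irrefl
        · exact h.2
      · intro h
        by_cases hx : x = v
        · exact Or.inl hx
        · exact Or.inr ⟨Ne.symm hx, h⟩
    have h2 : v ∉ N := by rw [hN]; exact Gᶜ.irrefl
    have h3 := card_insert_of_notMem h2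
    have h4 := card_filter_add_card_filter_not (s := univ) (fun x => G.Adj v x)
    rw [h1] at h3
    rw [card_univ, hV] at h4
    omega
  have hNR : (#N : ℝ) = 2 * n + 2 - s := by
    have : (#N : ℝ) + s = 2 * n + 2 := by exact_mod_cast hNcard
    linarith
  have hsR : (2 : ℝ) * s ≤ n + 1 := by exact_mod_cast hs
  obtain ⟨p, hp⟩ : ∃ p : V → Prop, ∀ x, p x ↔
      (2 * (n : ℝ) + 2 - s) / 6 + 1 ≤ #{z | Gᶜ.Adj x z ∧ Gᶜ.Adj v z} := ⟨_, fun _ => Iff.rfl⟩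
  have hclique : ∀ C ⊆ N, (∀ x ∈ C, p x) → (∀ x ∈ C, ∀ y ∈ C, x ∈ D ↔ y ∈ D) →
      DenseClique G n s C := by
    intro C hCN hC hCD
    refine ⟨by exact_mod_cast hV, ?_, ?_, hcodeg⟩
    · intro x hx y hy hxy
      by_contra hadj
      have h1 := hD x y ((hN x).1 (hCN hx)) ((hN y).1 (hCN hy)) ((hp x).1 (hC x hx))
        ((hp y).1 (hC y hy)) ((compl_adj _ _ _).2 ⟨hxy, hadj⟩)
      have h2 := hCD x hx y hy
      tauto
    · intro x _
      unfold relDeg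
      exact_mod_cast hmin x
  have hfew : ∀ w ∈ N, ¬ p w → ∀ M ⊆ N, w ∉ M →
      (#{x ∈ M | ¬ G.Adj w x} : ℝ) < #N / 6 + 1 := by
    intro w _ hpw M hM hwM
    rw [hp, not_le] at hpw
    rw [hNR]
    refine lt_of_le_of_lt ?_ hpw
    have : {x ∈ M | ¬ G.Adj w x} ⊆ univ.filter fun z => Gᶜ.Adj w z ∧ Gᶜ.Adj v z := by
      intro x hx
      rw [mem_filter] at hx
      refine mem_filter.2 ⟨mem_univ _, (compl_adj _ _ _).2 ⟨?_, hx.2⟩, (hN x).1 (hM hx.1)⟩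
      rintro rfl
      exact hwM hx.1
    exact_mod_cast card_le_card this
  have hA : {x ∈ N | p x ∧ x ∈ D} ⊆ N := filter_subset _ _
  have hB : {x ∈ N | p x ∧ x ∉ D} ⊆ N := filter_subset _ _
  have hR : {x ∈ N | ¬ p x} ⊆ N := filter_subset _ _
  have dAB : Disjoint {x ∈ N | p x ∧ x ∈ D} {x ∈ N | p x ∧ x ∉ D} := by
    rw [Finset.disjoint_left]; intro x; simp only [mem_filter]; tauto
  have dAR : Disjoint {x ∈ N | p x ∧ x ∈ D} {x ∈ N | ¬ p x} := by
    rw [Finset.disjoint_left]; intro x; simp only [mem_filter]; tauto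
  have dBR : Disjoint {x ∈ N | p x ∧ x ∉ D} {x ∈ N | ¬ p x} := by
    rw [Finset.disjoint_left]; intro x; simp only [mem_filter]; tauto
  refine ⟨{x ∈ N | p x ∧ x ∈ D}, {x ∈ N | p x ∧ x ∉ D}, {x ∈ N | ¬ p x},
    hclique _ hA (fun x hx => (mem_filter.1 hx).2.1)
      (fun x hx y hy => iff_of_true (mem_filter.1 hx).2.2 (mem_filter.1 hy).2.2),
    hclique _ hB (fun x hx => (mem_filter.1 hx).2.1)
      (fun x hx y hy => iff_of_false (mem_filter.1 hx).2.2 (mem_filter.1 hy).2.2),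
    dAB, dAR, dBR, fun x hx => hNv x (hA hx), fun x hx => hNv x (hB hx),
    fun x hx => hNv x (hR hx), ?_, hv, hs, ?_, ?_⟩
  · have h1 : N = {x ∈ N | p x ∧ x ∈ D} ∪ {x ∈ N | p x ∧ x ∉ D} ∪ {x ∈ N | ¬ p x} := by
      ext x; simp only [mem_union, mem_filter]; tauto
    have h2 := congrArg card h1
    rw [card_union_of_disjoint (disjoint_union_left.2 ⟨dAR, dBR⟩),
      card_union_of_disjoint dAB] at h2
    omega
  · refine card_le_of_few_not_adj hn hcodeg (N := N) (by linarith) fun w hw => ?_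
    rw [mem_filter] at hw
    have h1 := hfew w hw.1 hw.2 (N.erase w) (erase_subset _ _) (notMem_erase _ _)
    have h2 : {x ∈ N | ¬ G.Adj w x} ⊆ insert w {x ∈ N.erase w | ¬ G.Adj w x} := by
      intro x hx
      simp only [mem_insert, mem_filter, mem_erase] at hx ⊢
      tauto
    have h3 := (card_le_card h2).trans (card_insert_le _ _)
    have h4 : (#{x ∈ N | ¬ G.Adj w x} : ℝ) ≤ #{x ∈ N.erase w | ¬ G.Adj w x} + 1 := by
      exact_mod_cast h3
    linarith
  · intro w hw
    have h1 := hfew w (hR hw) (mem_filter.1 hw).2 _ (union_subset hA hB) (by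
      rw [mem_union, not_or]
      exact ⟨Finset.disjoint_right.1 dAR hw, Finset.disjoint_right.1 dBR hw⟩)
    rw [filter_union, card_union_of_disjoint (disjoint_filter_filter dAB)] at h1
    push_cast at h1
    have : (0 : ℝ) ≤ s := Nat.cast_nonneg s
    linarith

end Neighbourhood

/-- There exist `N₀, M₀` such that for every odd `m ≥ M₀` and every `n ≥ N₀` with `n ≥ 4m`
the following holds. Let `G` be a graph on `3n+4` vertices containing no copy of `K_{2,n}`
whose complement contains no copy of `W_m`, let `v` be a vertex of maximum degree in `G̅`
with `(3/2)(n+1) ≤ Δ(G̅) ≤ 2(n+1)`, and let `Q` be the set of vertices `x ∈ N_{G̅}(v)`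
whose degree in the induced subgraph `H̅ = G̅[N_{G̅}(v)]` (namely
`|N_{G̅}(x) ∩ N_{G̅}(v)|`) is at least `|N_{G̅}(v)|/6 + 1`. Then the subgraph of `G̅`
induced on `Q` is not bipartite. -/
theorem statement11 :
    ∃ N₀ M₀ : ℕ, ∀ m n : ℕ, Odd m → M₀ ≤ m → N₀ ≤ n → 4 * m ≤ n →
      ∀ (G : SimpleGraph (Fin (3 * n + 4))) [DecidableRel G.Adj],
        ¬ ContainsCopy G (completeBipartiteGraph (Fin 2) (Fin n)) →
        ¬ ContainsCopy Gᶜ (wheelGraph m) →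
        ∀ v : Fin (3 * n + 4), (∀ w, Gᶜ.degree w ≤ Gᶜ.degree v) →
        (3 / 2 : ℝ) * (n + 1) ≤ (Gᶜ.degree v : ℝ) →
        (Gᶜ.degree v : ℝ) ≤ 2 * (n + 1) →
        ¬ IsBip (Gᶜ.induce {x : Fin (3 * n + 4) | x ∈ Gᶜ.neighborSet v ∧
            (Gᶜ.degree v : ℝ) / 6 + 1 ≤
              ((Gᶜ.neighborFinset x ∩ Gᶜ.neighborFinset v).card : ℝ)}) := by
  refine ⟨10 ^ 17, 5, fun m n hm hm5 hn hmn G _ hK hW v hmax hlow hhigh hbip => ?_⟩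
  classical
  obtain ⟨j, rfl⟩ : ∃ j, m = 2 * j + 5 := by
    obtain ⟨k, rfl⟩ := hm
    exact ⟨k - 2, by omega⟩
  obtain ⟨D, hD⟩ := hbip
  have hdeg : ∀ w, (Finset.univ.filter fun u => G.Adj w u).card + Gᶜ.degree w = 3 * n + 3 := by
    intro w
    have h1 := G.degree_compl w
    have h2 := G.degree_lt_card_verts w
    rw [Fintype.card_fin] at h1 h2
    rw [← G.neighborFinset_eq_filter, G.card_neighborFinset_eq_degree]
    omega
  have hhigh' : Gᶜ.degree v ≤ 2 * n + 2 := by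
    have : (Gᶜ.degree v : ℝ) ≤ 2 * n + 2 := by linarith
    exact_mod_cast this
  obtain ⟨s, hs⟩ := Nat.exists_eq_add_of_le hhigh'
  have hsR : (Gᶜ.degree v : ℝ) = 2 * n + 2 - s := by
    have : (2 * n + 2 : ℝ) = Gᶜ.degree v + s := by exact_mod_cast hs
    linarith
  have hs2 : 2 * s ≤ n + 1 := by
    have : (2 : ℝ) * s ≤ n + 1 := by linarith
    exact_mod_cast this
  have hcount : ∀ x, Gᶜ.neighborFinset x ∩ Gᶜ.neighborFinset v
      = Finset.univ.filter fun z => Gᶜ.Adj x z ∧ Gᶜ.Adj v z := by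
    intro x; ext z
    simp only [Finset.mem_inter, mem_neighborFinset, Finset.mem_filter, Finset.mem_univ, true_and]
  obtain ⟨A, B, R, h⟩ := exists_twoCliqueCover (G := G) (s := s) (v := v) 
    (D := Set.image Subtype.val D) hn (by simp) (fun x y hxy => by
      by_contra! hcon
      refine hK (containsCopy_completeBipartiteGraph hxy ?_)
      have h1 := sub_lt_iff_lt_add.1 hcon
      exact Nat.lt_succ_iff.1 (by exact_mod_cast h1))
    (by
      have h1 : (Finset.univ.filter fun u => G.Adj v u).card = n + 1 + s := by
        have := hdeg v; omega
      convert h1)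
    (fun w => by
      have h1 : n + 1 + s ≤ (Finset.univ.filter fun u => G.Adj w u).card := by
        have := hdeg w; have := hmax w; omega
      convert h1)
    hs2 (fun x y hx hy hpx hpy hxy => by
      have hx' : x ∈ {x : Fin (3 * n + 4) | x ∈ Gᶜ.neighborSet v ∧
            (Gᶜ.degree v : ℝ) / 6 + 1 ≤
              ((Gᶜ.neighborFinset x ∩ Gᶜ.neighborFinset v).card : ℝ)} := by
        refine ⟨hx, ?_⟩
        rw [hcount, hsR]
        convert hpx
      have hy' : y ∈ {x : Fin (3 * n + 4) | x ∈ Gᶜ.neighborSet v ∧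
            (Gᶜ.degree v : ℝ) / 6 + 1 ≤
              ((Gᶜ.neighborFinset x ∩ Gᶜ.neighborFinset v).card : ℝ)} := by
        refine ⟨hy, ?_⟩
        rw [hcount, hsR]
        convert hpy
      have hmem : ∀ z, z ∈ D ↔ z.1 ∈ Set.image Subtype.val D := fun z =>
        (Subtype.val_injective.mem_set_image).symm
      have := @hD ⟨x, hx'⟩ ⟨y, hy'⟩ hxy
      rwa [hmem, hmem] at this)
  exact hW (h.containsCopy_wheelGraph hn hmn)
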